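/- arXiv:1110.1960 — 2 statements merged into one kernel-verified Lean document; each statement's English description precedes it below -/
import Mathlib

section
/- Assume 0 ≤ v(c) < p/((q+1)(p−1)), let y ∈ Ω be a root of L_c(X), and let s ∈ Ω satisfy s^{1+q} = λ^p. Then there exists a polynomial A(S) ∈ Ω[S] of degree at most q/p − 1, all of whose coefficients lie in the field ℚ_p(c, y) and have valuation ≥ 0, such that every coefficient (as a polynomial in T) of the difference f_{q,c}(s·T + y) − [f_{q,c}(y)·(1 + s·T·A(s·T))^p + s^{1+q}·T^{1+q}] ∈ Ω[T] has valuation strictly greater than p/(p−1). -/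
open Polynomial

noncomputable section

/-- `K₀`: the fraction field of the Witt vectors over `𝔽̄_p`, i.e. the completion of `ℚ_p^ur`. -/
abbrev Kzero (p : ℕ) [Fact p.Prime] : Type :=
  FractionRing (WittVector p (AlgebraicClosure (ZMod p)))

/-- `Ω`: a fixed algebraic closure of `K₀`. -/
abbrev Omg (p : ℕ) [Fact p.Prime] : Type := AlgebraicClosure (Kzero p)

/-- `a_n = (-1)^q · (-p)^(p + p² + ⋯ + pⁿ)` as an element of a commutative ring. -/
def aCoef (R : Type) [CommRing R] (p n : ℕ) : R :=
  (-1) ^ p ^ n * (-(p : R)) ^ (Finset.sum (Finset.range n) fun i => p ^ (i + 1))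

/-- `f_{q,c}(X) = 1 + c·X^q + X^(1+q)` with `q = pⁿ`. -/
def fqc (R : Type) [CommRing R] (p n : ℕ) (c : R) : Polynomial R :=
  1 + C c * X ^ p ^ n + X ^ (p ^ n + 1)

/-- The modified monodromy polynomial `L_c(X) = X^(q²) − a_n·(c+X)·f_{q,c}(X)^(q−1)`. -/
def Lpoly (R : Type) [CommRing R] (p n : ℕ) (c : R) : Polynomial R :=
  X ^ (p ^ n * p ^ n) - C (aCoef R p n) * (C c + X) * fqc R p n c ^ (p ^ n - 1)

/-- The two laws of a rank one additive valuation, for a function whose value at `0` is ignored. -/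
structure IsAddVal {K : Type} [Field K] (v : K → ℚ) : Prop where
  map_mul : ∀ x y : K, x ≠ 0 → y ≠ 0 → v (x * y) = v x + v y
  map_add : ∀ x y : K, x ≠ 0 → y ≠ 0 → x + y ≠ 0 → min (v x) (v y) ≤ v (x + y)

/-- `x` has valuation at least `r`, the valuation of `0` being infinite. -/
def ValGE {K : Type} [Field K] (v : K → ℚ) (r : ℚ) (x : K) : Prop := x = 0 ∨ r ≤ v x

/-- Every coefficient of `F` has valuation at least `r`. -/
def CoeffGE {K : Type} [Field K] (v : K → ℚ) (r : ℚ) (F : K[X]) : Prop :=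
  ∀ i, ValGE v r (F.coeff i)

section Valuation

variable {K : Type} [Field K] {v : K → ℚ}

theorem add_pow_prime_pow_eq_sum {R : Type} [CommRing R] {p : ℕ} (hp : p.Prime) (x y : R) (n : ℕ) :
    (x + y) ^ p ^ n = x ^ p ^ n + y ^ p ^ n + p * ∑ k ∈ Finset.Ioo 0 (p ^ n),
      x ^ k * y ^ (p ^ n - k) * (((p ^ n).choose k / p : ℕ) : R) := by
  rw [add_pow_prime_pow_eq hp, mul_assoc, mul_assoc, Finset.mul_sum, Finset.mul_sum]
  congr 2
  refine Finset.sum_congr rfl fun k hk => ?_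
  obtain ⟨hk0, hkn⟩ := Finset.mem_Ioo.1 hk
  rw [← mul_pow_sub_one hk0.ne' x, ← mul_pow_sub_one (Nat.sub_pos_of_lt hkn).ne' y]
  ring

theorem add_pow_prime_eq_sum {R : Type} [CommRing R] {p : ℕ} (hp : p.Prime) (x y : R) :
    (x + y) ^ p = x ^ p + y ^ p + p * ∑ k ∈ Finset.Ioo 0 p,
      x ^ k * y ^ (p - k) * ((p.choose k / p : ℕ) : R) := by
  simpa using add_pow_prime_pow_eq_sum hp x y 1

theorem ValGE.mono {r r' : ℚ} {x : K} (h : ValGE v r x) (hr : r' ≤ r) : ValGE v r' x :=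
  h.imp id hr.trans

theorem ValGE.le {r : ℚ} {x : K} (h : ValGE v r x) (hx : x ≠ 0) : r ≤ v x :=
  h.resolve_left hx

theorem valGE_self (x : K) : ValGE v (v x) x := Or.inr le_rfl

theorem CoeffGE.mono {r r' : ℚ} {F : K[X]} (h : CoeffGE v r F) (hr : r' ≤ r) : CoeffGE v r' F :=
  fun i => (h i).mono hr

theorem coeffGE_C {r : ℚ} {x : K} (hx : ValGE v r x) : CoeffGE v r (C x) := fun i => by
  rw [coeff_C]
  split_ifs
  · exact hx
  · exact Or.inl rfl

theorem coeffGE_prime {p : ℕ} (hp : v (p : K) = 1) : CoeffGE v 1 (p : K[X]) := by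
  simpa using coeffGE_C (Or.inr hp.ge : ValGE v 1 (p : K))

namespace IsAddVal

theorem map_one (hv : IsAddVal v) : v 1 = 0 := by
  have := hv.map_mul 1 1 one_ne_zero one_ne_zero
  rw [mul_one] at this
  linarith

theorem map_neg_one (hv : IsAddVal v) : v (-1) = 0 := by
  have := hv.map_mul (-1) (-1) (by simp) (by simp)
  rw [neg_mul_neg, mul_one, hv.map_one] at this
  linarith

theorem map_neg (hv : IsAddVal v) (x : K) : v (-x) = v x := by
  by_cases hx : x = 0
  · simp [hx]
  · have := hv.map_mul (-1) x (by simp) hx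
    rw [neg_one_mul, hv.map_neg_one] at this
    linarith

theorem map_pow (hv : IsAddVal v) {x : K} (hx : x ≠ 0) (n : ℕ) : v (x ^ n) = n * v x := by
  induction n with
  | zero => simp [hv.map_one]
  | succ n ih =>
    rw [pow_succ, hv.map_mul _ _ (pow_ne_zero _ hx) hx, ih]
    push_cast
    ring

theorem map_div (hv : IsAddVal v) {x y : K} (hx : x ≠ 0) (hy : y ≠ 0) : v (x / y) = v x - v y := by
  have := hv.map_mul (x / y) y (div_ne_zero hx hy) hy
  rw [div_mul_cancel₀ x hy] at this
  linarith

theorem valGE_add (hv : IsAddVal v) {r : ℚ} {x y : K} (hx : ValGE v r x) (hy : ValGE v r y) :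
    ValGE v r (x + y) := by
  by_cases h0 : x = 0
  · simpa [h0] using hy
  by_cases h1 : y = 0
  · simpa [h1] using hx
  by_cases h2 : x + y = 0
  · exact Or.inl h2
  · exact Or.inr ((le_min (hx.le h0) (hy.le h1)).trans (hv.map_add x y h0 h1 h2))

theorem valGE_mul (hv : IsAddVal v) {r r' : ℚ} {x y : K} (hx : ValGE v r x) (hy : ValGE v r' y) :
    ValGE v (r + r') (x * y) := by
  by_cases h0 : x = 0
  · exact Or.inl (by simp [h0])
  by_cases h1 : y = 0
  · exact Or.inl (by simp [h1])
  · refine Or.inr ?_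
    rw [hv.map_mul x y h0 h1]
    exact add_le_add (hx.le h0) (hy.le h1)

theorem valGE_neg (hv : IsAddVal v) {r : ℚ} {x : K} (hx : ValGE v r x) : ValGE v r (-x) := by
  unfold ValGE
  rwa [neg_eq_zero, hv.map_neg]

theorem valGE_sum (hv : IsAddVal v) {ι : Type} {r : ℚ} (t : Finset ι) (x : ι → K)
    (h : ∀ i ∈ t, ValGE v r (x i)) : ValGE v r (∑ i ∈ t, x i) :=
  Finset.sum_induction x (ValGE v r) (fun _ _ => hv.valGE_add) (Or.inl rfl) h

theorem valGE_one (hv : IsAddVal v) : ValGE v 0 (1 : K) := Or.inr hv.map_one.ge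

theorem valGE_natCast (hv : IsAddVal v) (m : ℕ) : ValGE v 0 (m : K) := by
  induction m with
  | zero => exact Or.inl Nat.cast_zero
  | succ m ih =>
    rw [Nat.cast_succ]
    exact hv.valGE_add ih hv.valGE_one

theorem valGE_pow (hv : IsAddVal v) {r : ℚ} {x : K} (hx : ValGE v r x) (m : ℕ) : ValGE v (m * r)
    (x ^ m) := by
  induction m with
  | zero => simpa using hv.valGE_one
  | succ m ih =>
    rw [pow_succ]
    exact (hv.valGE_mul ih hx).mono (by push_cast; linarith)

/-- The valuation of a sum is that of its dominant term. -/
theorem map_add_eq (hv : IsAddVal v) {r : ℚ} {x z : K} (hx : x ≠ 0) (hz : ValGE v r z)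
    (h : v x < r) :
    x + z ≠ 0 ∧ v (x + z) = v x := by
  have hne : x + z ≠ 0 := by
    intro h0
    have hxz : x = -z := eq_neg_of_add_eq_zero_left h0
    have := (hxz ▸ hv.valGE_neg hz : ValGE v r x).le hx
    linarith
  refine ⟨hne, le_antisymm ?_ ((hv.valGE_add (valGE_self x) (hz.mono h.le)).le hne)⟩
  by_contra! hlt
  have h1 : ValGE v (min (v (x + z)) r) ((x + z) + -z) :=
    hv.valGE_add ((valGE_self _).mono (min_le_left _ _))
      (hv.valGE_neg (hz.mono (min_le_right _ _)))
  rw [add_neg_cancel_right] at h1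
  exact absurd (h1.le hx) (not_le.2 (lt_min hlt h))

theorem coeffGE_add (hv : IsAddVal v) {r : ℚ} {F G : K[X]} (hF : CoeffGE v r F)
    (hG : CoeffGE v r G) :
    CoeffGE v r (F + G) := fun i => by
  rw [coeff_add]
  exact hv.valGE_add (hF i) (hG i)

theorem coeffGE_neg (hv : IsAddVal v) {r : ℚ} {F : K[X]}
    (hF : CoeffGE v r F) : CoeffGE v r (-F) := fun i => by
  rw [coeff_neg]
  exact hv.valGE_neg (hF i)

theorem coeffGE_sub (hv : IsAddVal v) {r : ℚ} {F G : K[X]} (hF : CoeffGE v r F)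
    (hG : CoeffGE v r G) :
    CoeffGE v r (F - G) := by
  rw [sub_eq_add_neg]
  exact hv.coeffGE_add hF (hv.coeffGE_neg hG)

theorem coeffGE_mul (hv : IsAddVal v) {r r' : ℚ} {F G : K[X]} (hF : CoeffGE v r F)
    (hG : CoeffGE v r' G) :
    CoeffGE v (r + r') (F * G) := fun i => by
  rw [coeff_mul]
  exact hv.valGE_sum _ _ fun j _ => hv.valGE_mul (hF _) (hG _)

theorem coeffGE_X (hv : IsAddVal v) : CoeffGE v 0 (X : K[X]) := fun i => by
  rw [coeff_X]
  split_ifs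
  · exact hv.valGE_one
  · exact Or.inl rfl

theorem coeffGE_one (hv : IsAddVal v) : CoeffGE v 0 (1 : K[X]) := by
  simpa using coeffGE_C hv.valGE_one

theorem coeffGE_natCast (hv : IsAddVal v) (m : ℕ) : CoeffGE v 0 (m : K[X]) := by
  simpa using coeffGE_C (hv.valGE_natCast m)

theorem coeffGE_pow (hv : IsAddVal v) {r : ℚ} {F : K[X]} (hF : CoeffGE v r F) (m : ℕ) :
    CoeffGE v (m * r) (F ^ m) := by
  induction m with
  | zero => simpa using hv.coeffGE_one
  | succ m ih =>
    rw [pow_succ]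
    exact (hv.coeffGE_mul ih hF).mono (by push_cast; linarith)

theorem coeffGE_sum (hv : IsAddVal v) {ι : Type} {r : ℚ} (t : Finset ι) (F : ι → K[X])
    (h : ∀ i ∈ t, CoeffGE v r (F i)) : CoeffGE v r (∑ i ∈ t, F i) :=
  Finset.sum_induction F (CoeffGE v r) (fun _ _ => hv.coeffGE_add) (fun _ => Or.inl rfl) h

section Frobenius

variable {p : ℕ} [Fact p.Prime]

theorem coeffGE_add_pow_sub (hv : IsAddVal v) (hp : v (p : K) = 1) {ω : ℚ} (hω : 0 ≤ ω)
    {F G : K[X]} (hF : CoeffGE v ω F)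
    (hG : CoeffGE v ω G) : CoeffGE v (1 + 2 * ω) ((F + G) ^ p - (F ^ p + G ^ p)) := by
  have h2 : (2 : ℚ) ≤ p := mod_cast (Fact.out : p.Prime).two_le
  rw [add_pow_prime_eq_sum Fact.out, add_sub_cancel_left]
  refine hv.coeffGE_mul (coeffGE_prime hp) (hv.coeffGE_sum _ _ fun k hk => ?_)
  have hk' := Finset.mem_Ioo.1 hk
  refine (hv.coeffGE_mul (hv.coeffGE_mul (hv.coeffGE_pow hF k) (hv.coeffGE_pow hG (p - k)))
    (hv.coeffGE_natCast _)).mono ?_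
  rw [Nat.cast_sub hk'.2.le]
  nlinarith

theorem coeffGE_sum_pow_sub (hv : IsAddVal v) (hp : v (p : K) = 1) {ω : ℚ} (hω : 0 ≤ ω) (n : ℕ)
    (F : ℕ → K[X])
    (hF : ∀ i < n, CoeffGE v ω (F i)) :
    CoeffGE v (1 + 2 * ω)
      ((∑ i ∈ Finset.range n, F i) ^ p - ∑ i ∈ Finset.range n, F i ^ p) := by
  induction n with
  | zero =>
    have hp0 : p ≠ 0 := (Fact.out : p.Prime).ne_zero
    intro i
    exact Or.inl (by simp [hp0])
  | succ n ih =>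
    have h1 := hv.coeffGE_add_pow_sub hp hω
      (hv.coeffGE_sum (Finset.range n) F fun i hi => hF i (by grind)) (hF n n.lt_succ_self)
    have h2 := hv.coeffGE_add h1 (ih fun i hi => hF i (by lia))
    rw [Finset.sum_range_succ, Finset.sum_range_succ]
    convert h2 using 1
    ring

theorem coeffGE_one_add_pow_sub (hv : IsAddVal v) (hp : v (p : K) = 1) {ω : ℚ} (hω : 0 ≤ ω)
    {F : K[X]} (hF : CoeffGE v ω F) :
    CoeffGE v (1 + 2 * ω) ((1 + F) ^ p - (1 + F ^ p + p * F)) := by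
  have hpp : p.Prime := Fact.out
  have hins : Finset.Ioo 0 p = insert 1 (Finset.Ioo 1 p) := by
    ext i
    have := hpp.two_le
    simp only [Finset.mem_Ioo, Finset.mem_insert]
    lia
  have key : (1 + F) ^ p - (1 + F ^ p + p * F) =
      p * ∑ k ∈ Finset.Ioo 1 p, F ^ k * 1 ^ (p - k) * ((p.choose k / p : ℕ) : K[X]) := by
    rw [add_comm 1 F, add_pow_prime_eq_sum hpp, hins, Finset.sum_insert (by simp)]
    simp only [Nat.choose_one_right, Nat.div_self hpp.pos]
    push_cast
    ring
  rw [key]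
  refine hv.coeffGE_mul (coeffGE_prime hp) (hv.coeffGE_sum _ _ fun k hk => ?_)
  have hk' : (2 : ℚ) ≤ k := mod_cast (Finset.mem_Ioo.1 hk).1
  rw [one_pow, mul_one]
  refine (hv.coeffGE_mul (hv.coeffGE_pow hF k) (hv.coeffGE_natCast _)).mono ?_
  nlinarith

end Frobenius

end IsAddVal

end Valuation

section Root

variable {K : Type} [Field K] (p n : ℕ)

theorem fqc_eval (c y : K) : (fqc K p n c).eval y = 1 + y ^ p ^ n * (c + y) := by
  simp only [fqc, eval_add, eval_one, eval_mul, eval_C, eval_pow, eval_X]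
  ring

theorem fqc_comp (c y s : K) : (fqc K p n c).comp (C s * X + C y) =
    1 + (C s * X + C y) ^ p ^ n * (C c + (C s * X + C y)) := by
  simp only [fqc, add_comp, one_comp, mul_comp, C_comp, pow_comp, X_comp]
  ring

theorem pow_eq_of_isRoot_Lpoly {c y : K} (hy : (Lpoly K p n c).IsRoot y) :
    y ^ (p ^ n * p ^ n) = aCoef K p n * (c + y) * (fqc K p n c).eval y ^ (p ^ n - 1) := by
  have := hy.eq_zero
  simp only [Lpoly, eval_sub, eval_mul, eval_add, eval_C, eval_pow, eval_X] at this
  exact sub_eq_zero.1 this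

theorem sum_pow_succ_mul (k : ℕ) :
    ((∑ i ∈ Finset.range k, p ^ (i + 1) : ℕ) : ℚ) * (p - 1) = p * ((p : ℚ) ^ k - 1) := by
  induction k with
  | zero => simp
  | succ k ih =>
    rw [Finset.sum_range_succ, Nat.cast_add, add_mul, ih]
    push_cast
    ring

/-- The coefficient of `S ^ p ^ k` in `S * A(S)`. -/
def expCoeff (p n : ℕ) (f y : K) (k : ℕ) : K :=
  y ^ (p ^ n * p ^ k) /
    ((-1) ^ p ^ k * (-(p : K)) ^ (1 + ∑ i ∈ Finset.range k, p ^ (i + 1)) * f ^ p ^ k)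

/-- The coefficient of `S ^ p ^ k` in the telescoping sum `∑ (p * g k + g k ^ p)`. -/
def telCoeff (p n : ℕ) (f y : K) (k : ℕ) : K :=
  y ^ (p ^ n * p ^ k) /
    ((-1) ^ p ^ k * (-(p : K)) ^ (∑ i ∈ Finset.range k, p ^ (i + 1)) * f ^ p ^ k)

theorem expCoeff_pow (f y : K) (k : ℕ) :
    expCoeff p n f y k ^ p = telCoeff p n f y (k + 1) := by
  have hsum : (1 + ∑ i ∈ Finset.range k, p ^ (i + 1)) * p =
      ∑ i ∈ Finset.range (k + 1), p ^ (i + 1) := by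
    rw [Finset.sum_range_succ', add_mul, Finset.sum_mul, add_comm]
    simp [pow_succ]
  rw [expCoeff, telCoeff, div_pow, mul_pow, mul_pow, ← pow_mul, ← pow_mul, ← pow_mul, ← pow_mul,
    hsum, mul_assoc, ← pow_succ]

theorem mul_expCoeff (hp : (p : K) ≠ 0) (f y : K) (k : ℕ) :
    (p : K) * expCoeff p n f y k = -telCoeff p n f y k := by
  have h : (-(p : K)) ≠ 0 := neg_ne_zero.2 hp
  have hb : expCoeff p n f y k = telCoeff p n f y k / (-(p : K)) := by
    rw [expCoeff, telCoeff, div_div, pow_add, pow_one]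
    congr 1
    ring
  rw [hb]
  field_simp

theorem telCoeff_zero {f : K} (hf : f ≠ 0) (y : K) : f * telCoeff p n f y 0 = -y ^ p ^ n := by
  simp only [telCoeff, pow_zero, mul_one, Finset.range_zero, Finset.sum_empty, pow_one]
  field_simp

theorem telCoeff_top (hp : (p : K) ≠ 0) {c y : K} (hf : (fqc K p n c).eval y ≠ 0)
    (hy : (Lpoly K p n c).IsRoot y) :
    (fqc K p n c).eval y * telCoeff p n ((fqc K p n c).eval y) y n = c + y := by
  have hp0 : 0 < p := Nat.pos_of_ne_zero (by rintro rfl; simp at hp)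
  have ha : aCoef K p n ≠ 0 :=
    mul_ne_zero (pow_ne_zero _ (by simp)) (pow_ne_zero _ (neg_ne_zero.2 hp))
  have h := pow_eq_of_isRoot_Lpoly p n hy
  rw [telCoeff, h, ← aCoef]
  have hpow := mul_pow_sub_one (pow_pos hp0 n).ne' ((fqc K p n c).eval y)
  rw [← hpow]
  field_simp

theorem telescope (hp : (p : K) ≠ 0) (f y : K) (S : K[X]) (m : ℕ) :
    (p : K[X]) * ∑ k ∈ Finset.range m, C (expCoeff p n f y k) * S ^ p ^ k +
        ∑ k ∈ Finset.range m, (C (expCoeff p n f y k) * S ^ p ^ k) ^ p =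
      C (telCoeff p n f y m) * S ^ p ^ m - C (telCoeff p n f y 0) * S := by
  rw [Finset.mul_sum, ← Finset.sum_add_distrib]
  have h : ∀ k, (p : K[X]) * (C (expCoeff p n f y k) * S ^ p ^ k) +
      (C (expCoeff p n f y k) * S ^ p ^ k) ^ p =
      C (telCoeff p n f y (k + 1)) * S ^ p ^ (k + 1) - C (telCoeff p n f y k) * S ^ p ^ k := by
    intro k
    rw [mul_pow, ← C_pow, expCoeff_pow, ← pow_mul, ← pow_succ, ← mul_assoc, ← C_eq_natCast,
      ← C_mul, mul_expCoeff p n hp, C_neg]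
    ring
  simp only [h]
  rw [Finset.sum_range_sub (fun k => C (telCoeff p n f y k) * S ^ p ^ k)]
  simp

theorem IsAddVal.map_aCoef {v : K → ℚ} (hv : IsAddVal v) (hvp : v (p : K) = 1)
    (hp : (p : K) ≠ 0) :
    v (aCoef K p n) * (p - 1) = p * ((p : ℚ) ^ n - 1) := by
  rw [aCoef, hv.map_mul _ _ (pow_ne_zero _ (by simp)) (pow_ne_zero _ (neg_ne_zero.2 hp)),
    hv.map_pow (by simp), hv.map_pow (neg_ne_zero.2 hp), hv.map_neg_one, hv.map_neg, hvp,
    ← sum_pow_succ_mul]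
  ring

variable [Fact p.Prime] {v : K → ℚ}

/-- Valuations of a root `y` of `L_c` and of `f_{q,c}(y)`. -/
theorem IsAddVal.of_isRoot_Lpoly (hv : IsAddVal v) (hvp : v (p : K) = 1)
    (hp : (p : K) ≠ 0) (hn : 1 ≤ n) {c y : K} (hc0 : c ≠ 0)
    (hc : 0 ≤ v c) (hc_lt : v c < (p : ℚ) / (((p : ℚ) ^ n + 1) * ((p : ℚ) - 1)))
    (hy : (Lpoly K p n c).IsRoot y) :
    y ≠ 0 ∧ (fqc K p n c).eval y ≠ 0 ∧ v ((fqc K p n c).eval y) = 0 ∧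
      v c < v y ∧ ((p : ℚ) ^ n) ^ 2 * v y = p * ((p : ℚ) ^ n - 1) / (p - 1) + v c := by
  have hpp : p.Prime := Fact.out
  have h2 : (2 : ℚ) ≤ p := mod_cast hpp.two_le
  have hq : 1 < p ^ n := Nat.one_lt_pow (by lia) hpp.one_lt
  have hqQ : (1 : ℚ) < (p : ℚ) ^ n := mod_cast hq
  have ha0 : aCoef K p n ≠ 0 :=
    mul_ne_zero (pow_ne_zero _ (by simp)) (pow_ne_zero _ (neg_ne_zero.2 hp))
  have hva : v (aCoef K p n) = p * ((p : ℚ) ^ n - 1) / (p - 1) := by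
    rw [eq_div_iff (by linarith), hv.map_aCoef p n hvp hp]
  have hva_pos : 0 < v (aCoef K p n) := by
    rw [hva]
    exact div_pos (mul_pos (by linarith) (by linarith)) (by linarith)
  have hL := pow_eq_of_isRoot_Lpoly p n hy
  have hf_eq := fqc_eval p n c y
  set f := (fqc K p n c).eval y
  have hy0 : y ≠ 0 := by
    rintro rfl
    have hf1 : f = 1 := by rw [hf_eq, zero_pow (by lia)]; ring
    rw [zero_pow (by positivity), hf1, one_pow, add_zero, mul_one] at hL
    exact mul_ne_zero ha0 hc0 hL.symm
  have hrhs : aCoef K p n * (c + y) * f ^ (p ^ n - 1) ≠ 0 := hL ▸ pow_ne_zero _ hy0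
  have hcy : c + y ≠ 0 := fun h => hrhs (by simp [h])
  have hf0 : f ≠ 0 := fun h => hrhs (by rw [h, zero_pow (by lia)]; simp)
  have hval : ((p : ℚ) ^ n) ^ 2 * v y =
      v (aCoef K p n) + v (c + y) + ((p : ℚ) ^ n - 1) * v f := by
    have := congrArg v hL
    rw [hv.map_pow hy0, hv.map_mul _ _ (mul_ne_zero ha0 hcy) (pow_ne_zero _ hf0),
      hv.map_mul _ _ ha0 hcy, hv.map_pow hf0, Nat.cast_sub hq.le] at this
    push_cast at this
    linarith
  have hy_nonneg : 0 ≤ v y := by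
    by_contra! hneg
    have h1 : v (c + y) = v y := by
      rw [add_comm]
      exact (hv.map_add_eq hy0 (valGE_self c) (hneg.trans_le hc)).2
    have h3 : v (y ^ p ^ n * (c + y)) = ((p : ℚ) ^ n + 1) * v y := by
      rw [hv.map_mul _ _ (pow_ne_zero _ hy0) hcy, hv.map_pow hy0, h1]
      push_cast
      ring
    have h4 : v f = ((p : ℚ) ^ n + 1) * v y := by
      rw [hf_eq, add_comm, (hv.map_add_eq (mul_ne_zero (pow_ne_zero _ hy0) hcy) hv.valGE_one
        (by rw [h3]; nlinarith)).2, h3]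
    rw [h1, h4] at hval
    nlinarith
  have hcy_nonneg : 0 ≤ v (c + y) := (hv.valGE_add (Or.inr hc) (Or.inr hy_nonneg)).le hcy
  have hterm : ValGE v ((p ^ n : ℕ) * v y + 0) (y ^ p ^ n * (c + y)) :=
    hv.valGE_mul (hv.valGE_pow (valGE_self y) _) (Or.inr hcy_nonneg)
  push_cast at hterm
  have hf_nonneg : 0 ≤ v f := by
    refine ValGE.le ?_ hf0
    rw [hf_eq]
    exact hv.valGE_add hv.valGE_one (hterm.mono (by nlinarith))
  have hy_pos : 0 < v y := by
    rcases hy_nonneg.eq_or_lt with h | h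
    · rw [← h] at hval
      nlinarith
    · exact h
  have hvf : v f = 0 := by
    rw [hf_eq, (hv.map_add_eq one_ne_zero hterm (by rw [hv.map_one]; nlinarith)).2, hv.map_one]
  rw [hvf, mul_zero, add_zero] at hval
  have hlt : v c < v y := by
    by_contra! hle
    have h1 : v y ≤ v (c + y) := (hv.valGE_add (Or.inr hle) (valGE_self y)).le hcy
    have h3 : (p : ℚ) / (((p : ℚ) ^ n + 1) * ((p : ℚ) - 1)) ≤ v y := by
      rw [div_le_iff₀ (mul_pos (by linarith) (by linarith))]
      have h4 := hv.map_aCoef p n hvp hp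
      have h5 : p * ((p : ℚ) ^ n - 1) ≤
          (v y * (((p : ℚ) ^ n + 1) * ((p : ℚ) - 1))) * ((p : ℚ) ^ n - 1) := by
        rw [← h4]
        have h6 : v (aCoef K p n) ≤ (((p : ℚ) ^ n) ^ 2 - 1) * v y := by linarith
        have := mul_le_mul_of_nonneg_right h6 (by linarith : (0 : ℚ) ≤ p - 1)
        linarith
      exact le_of_mul_le_mul_right h5 (by linarith)
    linarith
  refine ⟨hy0, hf0, hvf, hlt, ?_⟩
  rw [hval, (hv.map_add_eq hc0 (valGE_self y) hlt).2, hva]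

/-- The valuation of the coefficients of `S * A(S)`. -/
theorem IsAddVal.map_expCoeff (hv : IsAddVal v) (hvp : v (p : K) = 1)
    (hp : (p : K) ≠ 0) {f y : K} (hf : f ≠ 0) (hvf : v f = 0)
    (hy : y ≠ 0) {γ : ℚ}
    (hvy : ((p : ℚ) ^ n) ^ 2 * v y = p * ((p : ℚ) ^ n - 1) / (p - 1) + γ) (k : ℕ) :
    v (expCoeff p n f y k) =
      (1 - (p : ℚ) ^ (k + 1) / (p : ℚ) ^ n) / (p - 1) + (p : ℚ) ^ k * γ / (p : ℚ) ^ n := by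
  have hp2 : (2 : ℚ) ≤ p := mod_cast (Fact.out : p.Prime).two_le
  have hp1 : (p : ℚ) - 1 ≠ 0 := by linarith
  have hp0 : (p : ℚ) ≠ 0 := by linarith
  have h1 : ((-1 : K)) ^ p ^ k ≠ 0 := pow_ne_zero _ (by simp)
  have h2 : (-(p : K)) ^ (1 + ∑ i ∈ Finset.range k, p ^ (i + 1)) ≠ 0 :=
    pow_ne_zero _ (neg_ne_zero.2 hp)
  have h3 : f ^ p ^ k ≠ 0 := pow_ne_zero _ hf
  have hsum : ((∑ i ∈ Finset.range k, p ^ (i + 1) : ℕ) : ℚ) = p * ((p : ℚ) ^ k - 1) / (p - 1) := by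
    rw [eq_div_iff hp1, sum_pow_succ_mul]
  have hvy' : v y = (p * ((p : ℚ) ^ n - 1) / (p - 1) + γ) / ((p : ℚ) ^ n) ^ 2 := by
    rw [← hvy]
    field_simp
  rw [expCoeff, hv.map_div (pow_ne_zero _ hy) (mul_ne_zero (mul_ne_zero h1 h2) h3),
    hv.map_mul _ _ (mul_ne_zero h1 h2) h3, hv.map_mul _ _ h1 h2, hv.map_pow hy,
    hv.map_pow (by simp), hv.map_pow (neg_ne_zero.2 hp), hv.map_pow hf, hv.map_neg_one,
    hv.map_neg, hvp, hvf, Nat.cast_add, hsum, hvy']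
  push_cast
  field_simp
  ring

end Root

section Expansion

variable {K : Type} [Field K] (p n : ℕ)

/-- The polynomial `A(S)`. -/
def expPoly (p n : ℕ) (f y : K) : K[X] :=
  ∑ k ∈ Finset.range n, C (expCoeff p n f y k) * X ^ (p ^ k - 1)

theorem mul_expPoly_comp [Fact p.Prime] (f y : K) (S : K[X]) :
    S * (expPoly p n f y).comp S =
      ∑ k ∈ Finset.range n, C (expCoeff p n f y k) * S ^ p ^ k := by
  rw [expPoly, sum_comp, Finset.mul_sum]
  refine Finset.sum_congr rfl fun k _ => ?_
  rw [mul_comp, C_comp, pow_comp, X_comp, mul_left_comm,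
    mul_pow_sub_one (pow_pos (Fact.out : p.Prime).pos k).ne']

theorem natDegree_expPoly_le [Fact p.Prime] (f y : K) :
    (expPoly p n f y).natDegree ≤ p ^ (n - 1) - 1 := by
  refine natDegree_sum_le_of_forall_le _ _ fun k hk => (natDegree_C_mul_X_pow_le _ _).trans ?_
  have : p ^ k ≤ p ^ (n - 1) :=
    Nat.pow_le_pow_right (Fact.out : p.Prime).pos (by have := Finset.mem_range.1 hk; lia)
  lia

theorem expPoly_coeff_mem (F : Subfield K) {f y : K} (hf : f ∈ F) (hy : y ∈ F) (i : ℕ) :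
    (expPoly p n f y).coeff i ∈ F := by
  rw [expPoly, finsetSum_coeff]
  refine sum_mem fun k _ => ?_
  rw [coeff_C_mul_X_pow]
  split_ifs
  · exact div_mem (pow_mem hy _) (mul_mem (mul_mem (pow_mem (neg_mem (one_mem F)) _)
      (pow_mem (neg_mem (natCast_mem F p)) _)) (pow_mem hf _))
  · exact zero_mem F

/-- The error term of the expansion, as the sum of the part coming from the binomial expansion of
`(S + y) ^ q` and the one coming from `(1 + S * A(S)) ^ p`. -/
theorem fqc_comp_sub_eq [Fact p.Prime] (hp : (p : K) ≠ 0) {c y s : K}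
    (hf : (fqc K p n c).eval y ≠ 0) (hy : (Lpoly K p n c).IsRoot y) :
    let f := (fqc K p n c).eval y
    let S : K[X] := C s * X
    let g : ℕ → K[X] := fun k => C (expCoeff p n f y k) * S ^ p ^ k
    (fqc K p n c).comp (C s * X + C y) -
        (C f * (1 + C s * X * (expPoly p n f y).comp (C s * X)) ^ p +
          C (s ^ (p ^ n + 1)) * X ^ (p ^ n + 1)) =
      ((p : K[X]) * ∑ k ∈ Finset.Ioo 0 (p ^ n),
        S ^ k * C y ^ (p ^ n - k) * (((p ^ n).choose k / p : ℕ) : K[X])) * (C c + (S + C y)) -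
      C f * (((1 + ∑ k ∈ Finset.range n, g k) ^ p -
          (1 + (∑ k ∈ Finset.range n, g k) ^ p + (p : K[X]) * ∑ k ∈ Finset.range n, g k)) +
        ((∑ k ∈ Finset.range n, g k) ^ p - ∑ k ∈ Finset.range n, g k ^ p)) := by
  intro f S g
  rw [fqc_comp, mul_expPoly_comp, C_pow, ← mul_pow]
  have htel := telescope p n hp f y S n
  have h0 : C f * C (telCoeff p n f y 0) = -C y ^ p ^ n := by
    rw [← C_mul, telCoeff_zero p n hf, C_neg, C_pow]
  have h1 : C f * C (telCoeff p n f y n) = C c + C y := by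
    rw [← C_mul, telCoeff_top p n hp hf hy, C_add]
  have hfC : C f = 1 + C y ^ p ^ n * (C c + C y) := by
    rw [show f = _ from fqc_eval p n c y]
    simp
  have hbin := add_pow_prime_pow_eq_sum (Fact.out : p.Prime) S (C y) n
  change 1 + (S + C y) ^ p ^ n * _ - (C f * (1 + ∑ k ∈ Finset.range n, g k) ^ p + S ^ _) = _
  change (p : K[X]) * ∑ k ∈ Finset.range n, g k + ∑ k ∈ Finset.range n, g k ^ p = _ at htel
  set E := ∑ k ∈ Finset.Ioo 0 (p ^ n),
    S ^ k * C y ^ (p ^ n - k) * (((p ^ n).choose k / p : ℕ) : K[X])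
  change 1 + (S + C y) ^ p ^ n * (C c + (S + C y)) - _ = _
  rw [hbin]
  generalize ∑ k ∈ Finset.range n, g k ^ p = G at *
  generalize ∑ k ∈ Finset.range n, g k = H at *
  linear_combination S * h0 - C f * htel - hfC - S ^ p ^ n * h1

/-- The congruence `f_{q,c}(sT + y) ≡ f_{q,c}(y) (1 + sT A(sT)) ^ p + s ^ (1 + q) T ^ (1 + q)`. -/
theorem IsAddVal.exists_expansion [Fact p.Prime] {v : K → ℚ} (hv : IsAddVal v)
    (hvp : v (p : K) = 1) (hp : (p : K) ≠ 0) (hn : 1 ≤ n) {c y s : K} (hc0 : c ≠ 0)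
    (hc : 0 ≤ v c) (hc_lt : v c < (p : ℚ) / (((p : ℚ) ^ n + 1) * ((p : ℚ) - 1)))
    (hy : (Lpoly K p n c).IsRoot y)
    (hvs : v s = (p : ℚ) / (((p : ℚ) ^ n + 1) * ((p : ℚ) - 1))) :
    let f := (fqc K p n c).eval y
    (∀ i, ValGE v 0 ((expPoly p n f y).coeff i)) ∧
      ∃ r, (p : ℚ) / (p - 1) < r ∧ CoeffGE v r ((fqc K p n c).comp (C s * X + C y) -
        (C f * (1 + C s * X * (expPoly p n f y).comp (C s * X)) ^ p +
          C (s ^ (p ^ n + 1)) * X ^ (p ^ n + 1))) := by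
  intro f
  obtain ⟨hy0, hf0, hvf, hlt, hvy⟩ := hv.of_isRoot_Lpoly p n hvp hp hn hc0 hc hc_lt hy
  have hpp : p.Prime := Fact.out
  have h2 : (2 : ℚ) ≤ p := mod_cast hpp.two_le
  have hqQ : (p : ℚ) ≤ (p : ℚ) ^ n := le_self_pow₀ (by linarith) (by lia)
  have hcoef := hv.map_expCoeff p n hvp hp hf0 hvf hy0 hvy
  have hkn : ∀ k < n, (p : ℚ) ^ (k + 1) ≤ (p : ℚ) ^ n := fun k hk =>
    pow_le_pow_right₀ (by linarith) hk
  rw [fqc_comp_sub_eq p n hp hf0 hy]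
  have hq' : ((p ^ n : ℕ) : ℚ) = (p : ℚ) ^ n := by push_cast; rfl
  set q : ℚ := (p : ℚ) ^ n
  have hp1 : (0 : ℚ) < p - 1 := by linarith
  have hq0 : (0 : ℚ) < q := by linarith
  have hcoef_nonneg : ∀ k < n, 0 ≤ v (expCoeff p n f y k) := by
    intro k hk
    rw [hcoef k]
    have : (p : ℚ) ^ (k + 1) / q ≤ 1 := (div_le_one hq0).2 (hkn k hk)
    have : 0 ≤ (1 - (p : ℚ) ^ (k + 1) / q) / (p - 1) := div_nonneg (by linarith) hp1.le
    positivity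
  constructor
  · intro i
    rw [expPoly, finsetSum_coeff]
    refine hv.valGE_sum _ _ fun k hk => ?_
    rw [coeff_C_mul_X_pow]
    split_ifs
    · exact Or.inr (hcoef_nonneg k (Finset.mem_range.1 hk))
    · exact Or.inl rfl
  set ω : ℚ := q / ((p - 1) * (q + 1)) with hω
  have hω0 : 0 ≤ ω := by positivity
  have hS : CoeffGE v (v s) (C s * X) := by
    simpa using hv.coeffGE_mul (coeffGE_C (valGE_self s)) hv.coeffGE_X
  have hg : ∀ k < n, CoeffGE v ω (C (expCoeff p n f y k) * (C s * X) ^ p ^ k) := by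
    intro k hk
    refine (hv.coeffGE_mul (coeffGE_C (valGE_self _)) (hv.coeffGE_pow hS _)).mono ?_
    have h3 : v (expCoeff p n f y k) + (p ^ k : ℕ) * v s - ω =
        (q - (p : ℚ) ^ (k + 1)) / (q * (q + 1) * (p - 1)) + (p : ℚ) ^ k * v c / q := by
      rw [hcoef k, hvs, hω]
      push_cast
      field_simp
      ring
    have h4 : 0 ≤ (q - (p : ℚ) ^ (k + 1)) / (q * (q + 1) * (p - 1)) :=
      div_nonneg (by linarith [hkn k hk]) (by positivity)
    have h5 : 0 ≤ (p : ℚ) ^ k * v c / q := by positivity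
    linarith
  set μ : ℚ := p * (q - 1) / (q ^ 2 * (p - 1)) with hμ
  have hμs : μ < v s := by
    rw [hμ, hvs, div_lt_div_iff₀ (by positivity) (by positivity)]
    have : 0 < p * (p - 1 : ℚ) := by positivity
    nlinarith
  have hμy : μ ≤ v y := by
    have : v y = μ + v c / q ^ 2 := by
      rw [hμ]
      field_simp
      field_simp at hvy
      linarith
    have : 0 ≤ v c / q ^ 2 := by positivity
    linarith
  have hbase : (1 : ℚ) + 1 / (p - 1) = p / (p - 1) := by
    field_simp
    ring
  refine ⟨min (1 + (v s + (q - 1) * μ)) (1 + 2 * ω), lt_min ?_ ?_, hv.coeffGE_sub ?_ ?_⟩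
  · have h3 : 1 / ((p : ℚ) - 1) ≤ q * μ := by
      rw [hμ, div_le_iff₀ hp1]
      have : q * (p * (q - 1) / (q ^ 2 * (p - 1))) * (p - 1) = p * (q - 1) / q := by
        field_simp
      rw [this, le_div_iff₀ hq0]
      nlinarith
    linarith
  · have h3 : 1 / ((p : ℚ) - 1) < 2 * ω := by
      rw [hω, ← mul_div_assoc, div_lt_div_iff₀ hp1 (by positivity)]
      nlinarith
    linarith
  · have hlin : CoeffGE v 0 (C c + (C s * X + C y)) := by
      refine hv.coeffGE_add (coeffGE_C (Or.inr hc)) (hv.coeffGE_add (hS.mono ?_)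
        (coeffGE_C (Or.inr (hc.trans hlt.le))))
      rw [hvs]
      positivity
    refine (hv.coeffGE_mul (hv.coeffGE_mul (coeffGE_prime hvp)
      (hv.coeffGE_sum (r := v s + (q - 1) * μ) _ _ fun k hk => ?_)) hlin).mono
      ((min_le_left _ _).trans (by linarith))
    have hk' := Finset.mem_Ioo.1 hk
    have hk1 : (1 : ℚ) ≤ k := mod_cast hk'.1
    refine (hv.coeffGE_mul (hv.coeffGE_mul (hv.coeffGE_pow hS k)
      (hv.coeffGE_pow (coeffGE_C (Or.inr hμy)) (p ^ n - k)))
      (hv.coeffGE_natCast _)).mono ?_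
    rw [Nat.cast_sub hk'.2.le, hq']
    nlinarith
  · have hfC : CoeffGE v 0 (C f) := coeffGE_C (Or.inr hvf.ge)
    refine (hv.coeffGE_mul hfC (hv.coeffGE_add
      (hv.coeffGE_one_add_pow_sub hvp hω0 (hv.coeffGE_sum _ _ fun k hk =>
        hg k (Finset.mem_range.1 hk)))
      (hv.coeffGE_sum_pow_sub hvp hω0 n _ hg))).mono ((min_le_right _ _).trans (by linarith))

end Expansion

set_option maxHeartbeats 1000000

/-- there is a polynomial `A(S)` of degree `≤ q/p − 1`, with coefficients in
`ℚ_p(c,y)` of nonnegative valuation, such that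
`f_{q,c}(sT + y) ≡ f_{q,c}(y)·(1 + sT·A(sT))^p + s^(1+q)·T^(1+q) mod λ^p·𝔪[T]`. -/
theorem stmt_6 (p n : ℕ) [Fact p.Prime] (hn : 1 ≤ n)
    (v : Omg p → ℚ)
    (hv_mul : ∀ x y : Omg p, x ≠ 0 → y ≠ 0 → v (x * y) = v x + v y)
    (hv_add : ∀ x y : Omg p, x ≠ 0 → y ≠ 0 → x + y ≠ 0 → min (v x) (v y) ≤ v (x + y))
    (hv_p : v ((p : ℕ) : Omg p) = 1)
    (hv_W : ∀ x : WittVector p (AlgebraicClosure (ZMod p)), x ≠ 0 →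
      0 ≤ v (algebraMap (Kzero p) (Omg p)
        (algebraMap (WittVector p (AlgebraicClosure (ZMod p))) (Kzero p) x)))
    (ζ : Omg p) (hζ : IsPrimitiveRoot ζ p) (hlam : v (ζ - 1) = 1 / ((p : ℚ) - 1))
    (c : Omg p) (hc0 : c ≠ 0) (hc_nonneg : 0 ≤ v c)
    (hc_lt : v c < (p : ℚ) / (((p : ℚ) ^ n + 1) * ((p : ℚ) - 1)))
    (y : Omg p) (hy : (Lpoly (Omg p) p n c).IsRoot y)
    (s : Omg p) (hs : s ^ (p ^ n + 1) = (ζ - 1) ^ p) :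
    ∃ A : Polynomial (Omg p),
      A.natDegree ≤ p ^ (n - 1) - 1 ∧
      (∀ i, A.coeff i ∈ Subfield.closure ({c, y} : Set (Omg p))) ∧
      (∀ i, A.coeff i = 0 ∨ 0 ≤ v (A.coeff i)) ∧
      ∀ D : Polynomial (Omg p),
        D = (fqc (Omg p) p n c).comp (C s * X + C y) -
          (C ((fqc (Omg p) p n c).eval y) * (1 + C s * X * A.comp (C s * X)) ^ p +
            C (s ^ (p ^ n + 1)) * X ^ (p ^ n + 1)) →
        ∀ i, D.coeff i = 0 ∨ (p : ℚ) / ((p : ℚ) - 1) < v (D.coeff i) := by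
  have hv : IsAddVal v := ⟨hv_mul, hv_add⟩
  have hpp : p.Prime := Fact.out
  have h2 : (2 : ℚ) ≤ p := mod_cast hpp.two_le
  have hp : ((p : ℕ) : Omg p) ≠ 0 := by
    have hW := (map_ne_zero_iff _ (IsFractionRing.injective
      (WittVector p (AlgebraicClosure (ZMod p))) (Kzero p))).2
      (WittVector.p_nonzero p (AlgebraicClosure (ZMod p)))
    simpa using (map_ne_zero (algebraMap (Kzero p) (Omg p))).2 hW
  have hζ1 : ζ - 1 ≠ 0 := sub_ne_zero.2 (hζ.ne_one hpp.one_lt)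
  have hs0 : s ≠ 0 := by
    rintro rfl
    rw [zero_pow (by lia)] at hs
    exact pow_ne_zero _ hζ1 hs.symm
  have hvs : v s = (p : ℚ) / (((p : ℚ) ^ n + 1) * ((p : ℚ) - 1)) := by
    have h := congrArg v hs
    rw [hv.map_pow hs0, hv.map_pow hζ1, hlam] at h
    have hp1 : (p : ℚ) - 1 ≠ 0 := by linarith
    push_cast at h
    field_simp at h ⊢
    linarith
  obtain ⟨hA, r, hr, hD⟩ :=
    hv.exists_expansion p n hv_p hp hn hc0 hc_nonneg hc_lt hy hvs
  have hc_mem : c ∈ Subfield.closure ({c, y} : Set (Omg p)) :=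
    Subfield.subset_closure (by simp)
  have hy_mem : y ∈ Subfield.closure ({c, y} : Set (Omg p)) :=
    Subfield.subset_closure (by simp)
  refine ⟨expPoly p n ((fqc (Omg p) p n c).eval y) y, natDegree_expPoly_le p n _ _,
    expPoly_coeff_mem p n _ ?_ hy_mem, hA, ?_⟩
  · rw [fqc_eval]
    exact add_mem (one_mem _) (mul_mem (pow_mem hy_mem _) (add_mem hc_mem hy_mem))
  · rintro D rfl i
    exact (hD i).imp id hr.trans_le
end
end

section
/- Assume c ∈ O_K with v(c^p − c) ≥ 1 and v(c) < p/((q+1)(p−1)). Then the polynomial L_c(X) is irreducible over K; in particular, for any root y ∈ Ω of L_c, the extension K(y)/K has degree q², and it is totally ramified. -/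
open Polynomial

noncomputable section

namespace AddValuation

variable {F : Type*} [Field F] (w : AddValuation F (WithTop ℚ))

lemma exists_coe_eq {x : F} (hx : x ≠ 0) : ∃ a : ℚ, w x = a := by
  obtain ⟨a, ha⟩ := WithTop.ne_top_iff_exists.1 ((w.ne_top_iff).2 hx)
  exact ⟨a, ha.symm⟩

variable {w}

lemma ne_zero_of_eq_coe {x : F} {a : ℚ} (h : w x = a) : x ≠ 0 := by
  rintro rfl
  simp at h

lemma mul_eq_coe {x y : F} {a b : ℚ} (hx : w x = a) (hy : w y = b) :
    w (x * y) = ((a + b : ℚ) : WithTop ℚ) := by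
  rw [w.map_mul, hx, hy, WithTop.coe_add]

lemma pow_eq_coe {x : F} {a : ℚ} (hx : w x = a) (k : ℕ) :
    w (x ^ k) = ((k * a : ℚ) : WithTop ℚ) := by
  rw [w.map_pow, hx, ← WithTop.coe_nsmul, nsmul_eq_mul]

lemma div_eq_coe {x y : F} {a b : ℚ} (hx : w x = a) (hy : w y = b) :
    w (x / y) = ((a - b : ℚ) : WithTop ℚ) := by
  have hy0 := ne_zero_of_eq_coe hy
  obtain ⟨d, hd⟩ := w.exists_coe_eq (div_ne_zero (ne_zero_of_eq_coe hx) hy0)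
  have h := mul_eq_coe hd hy
  rw [div_mul_cancel₀ _ hy0, hx, WithTop.coe_inj] at h
  rw [hd, h, add_sub_cancel_right]

lemma eq_coe_of_pow_eq_coe {x : F} {a : ℚ} {k : ℕ} (hk : k ≠ 0) (h : w (x ^ k) = a) :
    w x = ((a / k : ℚ) : WithTop ℚ) := by
  have hx : x ≠ 0 := by
    rintro rfl
    exact ne_zero_of_eq_coe h (zero_pow hk)
  obtain ⟨b, hb⟩ := w.exists_coe_eq hx
  have h' := pow_eq_coe hb k
  rw [h, WithTop.coe_inj] at h'
  have : (k : ℚ) ≠ 0 := by exact_mod_cast hk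
  rw [hb, h', mul_div_cancel_left₀ _ this]

lemma eq_zero_of_pow_eq_one {x : F} {k : ℕ} (hk : k ≠ 0) (h : x ^ k = 1) : w x = 0 := by
  have h1 : w (x ^ k) = ((0 : ℚ) : WithTop ℚ) := by simp [h]
  simpa using eq_coe_of_pow_eq_coe hk h1

lemma mul_nonneg {x y : F} (hx : 0 ≤ w x) (hy : 0 ≤ w y) : 0 ≤ w (x * y) := by
  rw [w.map_mul]
  exact add_nonneg hx hy

lemma le_mul_of_nonneg {x y : F} (hy : 0 ≤ w y) : w x ≤ w (x * y) := by
  rw [w.map_mul]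
  exact le_add_of_nonneg_right hy

lemma pow_nonneg {x : F} (hx : 0 ≤ w x) (k : ℕ) : 0 ≤ w (x ^ k) := by
  rw [w.map_pow]
  exact nsmul_nonneg hx k

lemma natCast_nonneg (k : ℕ) : 0 ≤ w (k : F) := by
  induction k with
  | zero => simp
  | succ k ih =>
    rw [Nat.cast_succ]
    exact w.map_le_add ih (by simp)

lemma exists_pow_sub_one_eq {x : F} (hx : 0 ≤ w x) (k : ℕ) :
    ∃ s, 0 ≤ w s ∧ x ^ k - 1 = (x - 1) * s :=
  ⟨∑ i ∈ Finset.range k, x ^ i, w.map_le_sum fun i _ => pow_nonneg hx i, by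
    rw [mul_comm, geom_sum_mul]⟩

lemma exists_add_pow_prime_eq {p : ℕ} (hp : p.Prime) {x y : F} (hx : 0 ≤ w x) (hy : 0 ≤ w y) :
    ∃ r, 0 ≤ w r ∧ (x + y) ^ p = x ^ p + y ^ p + p * r :=
  ⟨x * y * ∑ k ∈ Finset.Ioo 0 p, x ^ (k - 1) * y ^ (p - k - 1) * ↑(p.choose k / p),
    mul_nonneg (mul_nonneg hx hy) (w.map_le_sum fun _ _ =>
      mul_nonneg (mul_nonneg (pow_nonneg hx _) (pow_nonneg hy _)) (natCast_nonneg _)), by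
    rw [add_pow_prime_eq hp]; ring⟩

/-- If `ζ` is a primitive `p`-th root of unity and `w p = 1`, then `w (ζ - 1) = 1 / (p - 1)`. -/
lemma sub_one_eq_of_isPrimitiveRoot {p : ℕ} (hp : p.Prime) (hwp : w (p : F) = 1) {ζ : F}
    (hζ : IsPrimitiveRoot ζ p) : w (ζ - 1) = ((1 / ((p : ℚ) - 1) : ℚ) : WithTop ℚ) := by
  obtain ⟨m, rfl⟩ : ∃ m, p = m + 1 := ⟨p - 1, (Nat.sub_add_cancel hp.one_le).symm⟩
  have hm : m ≠ 0 := by rintro rfl; exact hp.ne_one rfl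
  have hw1 : ∀ x : F, x ^ (m + 1) = 1 → 0 ≤ w x := fun x hx =>
    (eq_zero_of_pow_eq_one (Nat.succ_ne_zero m) hx).ge
  have hle : ∀ x : F, x ^ (m + 1) = 1 → ∀ k, w (x - 1) ≤ w (x ^ k - 1) := fun x hx k => by
    obtain ⟨s, hs, h⟩ := exists_pow_sub_one_eq (hw1 x hx) k
    rw [h]
    exact le_mul_of_nonneg hs
  have hζ1 : ζ ^ (m + 1) = 1 := hζ.pow_eq_one
  have heq : ∀ k ∈ Finset.range m, w (1 - ζ ^ (k + 1)) = w (ζ - 1) := fun k hk => by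
    have hkm := Finset.mem_range.1 hk
    have hprim : IsPrimitiveRoot (ζ ^ (k + 1)) (m + 1) :=
      hζ.pow_of_coprime _
        (Nat.Coprime.symm ((Nat.Prime.coprime_iff_not_dvd hp).2
          (Nat.not_dvd_of_pos_of_lt k.succ_pos (by omega))))
    obtain ⟨j, -, hj⟩ := hprim.eq_pow_of_pow_eq_one hζ1
    rw [w.map_sub_swap]
    refine le_antisymm ?_ (hle ζ hζ1 _)
    have := hle _ hprim.pow_eq_one j
    rwa [hj] at this
  have hprod := hζ.prod_one_sub_pow_eq_order
  obtain ⟨a, ha⟩ := w.exists_coe_eq (sub_ne_zero.2 (hζ.ne_one hp.one_lt))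
  have hsum : ∀ s : Finset ℕ, s ⊆ Finset.range m →
      w (∏ k ∈ s, (1 - ζ ^ (k + 1))) = ((s.card * a : ℚ) : WithTop ℚ) := by
    intro s
    induction s using Finset.induction_on with
    | empty => simp
    | insert i s hi ih =>
      intro hs
      rw [Finset.prod_insert hi, mul_eq_coe ((heq i (hs (Finset.mem_insert_self i s))).trans ha)
        (ih ((Finset.subset_insert i s).trans hs)), Finset.card_insert_of_notMem hi]
      congr 1
      push_cast
      ring
  have h := hsum _ subset_rfl
  rw [hprod, ← Nat.cast_succ, hwp, Finset.card_range, ← WithTop.coe_one, WithTop.coe_inj] at h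
  have hm' : (m : ℚ) ≠ 0 := by exact_mod_cast hm
  rw [ha]
  congr 1
  rw [Nat.cast_succ, add_sub_cancel_right, eq_div_iff hm', mul_comm, ← h]

/-- If the valuations of the nonzero elements of `k` are integers and `w t = 1 / N`, then
`1, t, …, t ^ (N - 1)` are linearly independent over `k`. -/
lemma linearIndependent_pow {k : Type*} [Field k] [Algebra k F]
    (hk : ∀ x : k, x ≠ 0 → ∃ m : ℤ, w (algebraMap k F x) = ((m : ℚ) : WithTop ℚ))
    {N : ℕ} {t : F} (ht : w t = ((1 / (N : ℚ) : ℚ) : WithTop ℚ)) :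
    LinearIndependent k fun i : Fin N => t ^ (i : ℕ) := by
  classical
  rw [Fintype.linearIndependent_iff]
  intro g hg
  by_contra! hne
  obtain ⟨i₀, hi₀⟩ := hne
  have hval : ∀ i, g i ≠ 0 → ∃ m : ℤ, w (g i • t ^ (i : ℕ)) =
      ((m + (i : ℕ) * (1 / (N : ℚ)) : ℚ) : WithTop ℚ) := fun i hi => by
    obtain ⟨m, hm⟩ := hk _ hi
    exact ⟨m, by rw [Algebra.smul_def, mul_eq_coe hm (pow_eq_coe ht _)]⟩
  obtain ⟨i, hi, hmin⟩ := (Finset.univ.filter fun i => g i ≠ 0).exists_min_image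
    (fun i => w (g i • t ^ (i : ℕ))) ⟨i₀, by simpa using hi₀⟩
  simp only [Finset.mem_filter, Finset.mem_univ, true_and] at hi hmin
  obtain ⟨m, hm⟩ := hval i hi
  have hN : (0 : ℚ) < N := by exact_mod_cast i.pos
  have hlt : w (g i • t ^ (i : ℕ)) < w (∑ j ∈ Finset.univ.erase i, g j • t ^ (j : ℕ)) := by
    refine w.map_lt_sum (hm ▸ WithTop.coe_ne_top) fun j hj => ?_
    by_cases hj0 : g j = 0
    · rw [hj0, zero_smul, w.map_zero, hm]
      exact WithTop.coe_lt_top _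
    · refine lt_of_le_of_ne (hmin j hj0) fun heq => Finset.ne_of_mem_erase hj ?_
      obtain ⟨m', hm'⟩ := hval j hj0
      rw [hm, hm', WithTop.coe_inj] at heq
      field_simp at heq
      rw [mul_comm] at heq
      have heq' : (N : ℤ) * m + (i : ℕ) = N * m' + (j : ℕ) := by exact_mod_cast heq
      have hmod := congrArg (· % (N : ℤ)) heq'
      simp only [Int.mul_add_emod_self_left] at hmod
      rw [Int.emod_eq_of_lt (by positivity) (by exact_mod_cast i.2),
        Int.emod_eq_of_lt (by positivity) (by exact_mod_cast j.2)] at hmod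
      exact Fin.ext (by exact_mod_cast hmod.symm)
  rw [← Finset.add_sum_erase _ _ (Finset.mem_univ i)] at hg
  rw [← neg_eq_of_add_eq_zero_right hg, w.map_neg] at hlt
  exact lt_irrefl _ hlt

end AddValuation

section Monodromy

variable {F : Type} [Field F] {w : AddValuation F (WithTop ℚ)}

open AddValuation

/-- The `p`-th root `(-1) ^ pᵐ · (-p) ^ (1 + p + ⋯ + pᵐ)` of `a_{m+1}`. -/
def aRoot (R : Type) [CommRing R] (p m : ℕ) : R :=
  (-1) ^ p ^ m * (-(p : R)) ^ (Finset.sum (Finset.range (m + 1)) fun i => p ^ i)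

lemma aRoot_pow (R : Type) [CommRing R] (p m : ℕ) : aRoot R p m ^ p = aCoef R p (m + 1) := by
  rw [aRoot, aCoef, mul_pow, ← pow_mul, ← pow_mul, ← pow_succ, Finset.sum_mul]
  simp only [pow_succ]

lemma map_aRoot {p : ℕ} (hp : p.Prime) (hwp : w (p : F) = 1) (m : ℕ) :
    w (aRoot F p m) = ((((p : ℚ) ^ (m + 1) - 1) / (p - 1) : ℚ) : WithTop ℚ) := by
  have h1 : w ((-1 : F) ^ p ^ m) = ((0 : ℚ) : WithTop ℚ) := by simp
  have h2 : w (-(p : F)) = ((1 : ℚ) : WithTop ℚ) := by rw [w.map_neg, hwp]; rfl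
  have hp1 : (p : ℚ) ≠ 1 := by exact_mod_cast hp.ne_one
  rw [aRoot, mul_eq_coe h1 (pow_eq_coe h2 _), zero_add, mul_one, ← geom_sum_eq hp1]
  push_cast
  rfl

lemma map_root_eq {q : ℕ} (hq : 1 ≤ q) {a c y : F} {A : ℚ} (ha : w a = A) (hA : 0 < A)
    (hc : w c = 0)
    (hy : y ^ (q * q) = a * (c + y) * (1 + c * y ^ q + y ^ (q + 1)) ^ (q - 1)) :
    w y = ((A / (q * q : ℕ) : ℚ) : WithTop ℚ) := by
  have hqq : q * q ≠ 0 := by positivity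
  have hc' : w c = ((0 : ℚ) : WithTop ℚ) := by simpa using hc
  have hone : w (1 : F) = ((0 : ℚ) : WithTop ℚ) := by simp
  have hy0 : y ≠ 0 := by
    rintro rfl
    rw [zero_pow hqq, zero_pow (by omega), zero_pow (by omega)] at hy
    simp only [mul_zero, add_zero, one_pow, mul_one] at hy
    exact mul_ne_zero (ne_zero_of_eq_coe ha) (ne_zero_of_eq_coe hc') hy.symm
  obtain ⟨Y, hY⟩ := w.exists_coe_eq hy0
  have hyq := mul_eq_coe hc' (pow_eq_coe hY q)
  have hyq1 := pow_eq_coe hY (q + 1)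
  have hL := pow_eq_coe hY (q * q)
  have hq' : (1 : ℚ) ≤ q := by exact_mod_cast hq
  rcases lt_trichotomy Y 0 with hneg | rfl | hpos
  · exfalso
    have h1 : w (c + y) = Y := by
      rw [w.map_add_eq_of_lt_right (by rw [hY, hc']; exact_mod_cast hneg), hY]
    have h2 : w (1 + c * y ^ q + y ^ (q + 1)) = (((q + 1 : ℕ) * Y : ℚ) : WithTop ℚ) := by
      rw [w.map_add_eq_of_lt_right, hyq1]
      rw [hyq1]
      apply w.map_lt_add
      · rw [hone]
        exact_mod_cast mul_neg_of_pos_of_neg (by positivity) hneg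
      · rw [hyq, WithTop.coe_lt_coe]
        push_cast
        linarith
    rw [hy, mul_eq_coe (mul_eq_coe ha h1) (pow_eq_coe h2 _), WithTop.coe_inj] at hL
    push_cast [Nat.cast_sub hq] at hL
    exact hA.ne' (by linarith)
  · exfalso
    have h1 : 0 ≤ w (c + y) := w.map_le_add hc.ge (by rw [hY]; rfl)
    have h2 : 0 ≤ w (1 + c * y ^ q + y ^ (q + 1)) := by
      refine w.map_le_add (w.map_le_add (by simp) ?_) ?_
      · rw [hyq]; simp
      · rw [hyq1]; simp
    have h3 : w a ≤ w (y ^ (q * q)) := by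
      rw [hy, mul_assoc]
      exact le_mul_of_nonneg (AddValuation.mul_nonneg h1 (AddValuation.pow_nonneg h2 _))
    rw [hL, ha, WithTop.coe_le_coe] at h3
    linarith
  · have h1 : w (c + y) = ((0 : ℚ) : WithTop ℚ) := by
      rw [w.map_add_eq_of_lt_left (by rw [hY, hc']; exact_mod_cast hpos), hc']
    have h2 : w (1 + c * y ^ q + y ^ (q + 1)) = ((0 : ℚ) : WithTop ℚ) := by
      rw [add_assoc, w.map_add_eq_of_lt_left, hone]
      rw [hone]
      apply w.map_lt_add
      · rw [hyq, WithTop.coe_lt_coe]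
        nlinarith
      · rw [hyq1, WithTop.coe_lt_coe]
        positivity
    have h3 := mul_eq_coe (mul_eq_coe ha h1) (pow_eq_coe h2 (q - 1))
    rw [← hy] at h3
    rw [eq_coe_of_pow_eq_coe hqq h3]
    simp

/-- With `d ^ p = a`, the element `y ^ (q² / p) / d - c` of `K(y)` has valuation `v(y) / p`. -/
lemma map_root_pow_div_sub {p : ℕ} (hp : p.Prime) (hwp : w (p : F) = 1) {q N : ℕ}
    (hq : 2 ≤ q) (hN : N * p = q * q) {c y d : F} {Y : ℚ} (hY : w y = Y) (hY0 : 0 < Y)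
    (hY1 : Y < 1) (hd : d ≠ 0) (hc : w c = 0) (hcp : 1 ≤ w (c ^ p - c))
    (hy : y ^ (q * q) = d ^ p * (c + y) * (1 + c * y ^ q + y ^ (q + 1)) ^ (q - 1)) :
    w (y ^ N / d - c) = ((Y / p : ℚ) : WithTop ℚ) := by
  set g := y ^ N / d with hg
  set f := 1 + c * y ^ q + y ^ (q + 1) with hf
  have hgp : g ^ p = (c + y) * f ^ (q - 1) := by
    rw [hg, div_pow, ← pow_mul, hN, hy, mul_assoc, mul_div_cancel_left₀ _ (pow_ne_zero p hd)]
  have hc' : w c = ((0 : ℚ) : WithTop ℚ) := by simpa using hc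
  have hyn : 0 ≤ w y := by rw [hY]; exact_mod_cast hY0.le
  have hcy : 0 ≤ w (c + y) := w.map_le_add hc.ge hyn
  have hfn : 0 ≤ w f := w.map_le_add (w.map_le_add (by simp)
    (AddValuation.mul_nonneg hc.ge (AddValuation.pow_nonneg hyn _)))
    (AddValuation.pow_nonneg hyn _)
  have hgn : 0 ≤ w g := by
    have h0 : 0 ≤ w (g ^ p) := by
      rw [hgp]
      exact AddValuation.mul_nonneg hcy (AddValuation.pow_nonneg hfn _)
    rcases eq_or_ne g 0 with h | h
    · simp [h]
    · obtain ⟨b, hb⟩ := w.exists_coe_eq h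
      rw [pow_eq_coe hb, ← WithTop.coe_zero, WithTop.coe_le_coe] at h0
      rw [hb, ← WithTop.coe_zero, WithTop.coe_le_coe]
      exact nonneg_of_mul_nonneg_right h0 (by exact_mod_cast hp.pos)
  obtain ⟨s, hs, hfs⟩ := exists_pow_sub_one_eq hfn (q - 1)
  obtain ⟨r, hr, hgr⟩ := exists_add_pow_prime_eq hp (w.map_le_sub hgn hc.ge) hc.ge
  rw [sub_add_cancel, hgp] at hgr
  have hone : (Y : WithTop ℚ) < 1 := by exact_mod_cast hY1
  have hmain : (g - c) ^ p = y + ((c + y) * (y ^ q * (c + y) * s) - (c ^ p - c) - p * r) := by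
    have h1 : f - 1 = y ^ q * (c + y) := by rw [hf]; ring
    rw [h1] at hfs
    linear_combination -hgr + (c + y) * hfs
  have hlt : w y < w ((c + y) * (y ^ q * (c + y) * s) - (c ^ p - c) - p * r) := by
    rw [hY, sub_eq_add_neg, sub_eq_add_neg]
    refine w.map_lt_add (w.map_lt_add ?_ ?_) ?_
    · rw [show (c + y) * (y ^ q * (c + y) * s) = y ^ q * ((c + y) * (c + y) * s) by ring]
      refine lt_of_lt_of_le ?_ (le_mul_of_nonneg
        (AddValuation.mul_nonneg (AddValuation.mul_nonneg hcy hcy) hs))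
      rw [pow_eq_coe hY, WithTop.coe_lt_coe]
      have : (2 : ℚ) ≤ q := by exact_mod_cast hq
      nlinarith
    · rw [w.map_neg]
      exact hone.trans_le hcp
    · rw [w.map_neg]
      exact hone.trans_le (hwp ▸ le_mul_of_nonneg hr)
  apply eq_coe_of_pow_eq_coe hp.ne_zero
  rw [hmain, w.map_add_eq_of_lt_left hlt, hY]

/-- The uniformizer `μ / (y ^ (q² / p) / d - c)` of `K(y)`. -/
lemma map_uniformizer {p : ℕ} (hp : p.Prime) (hwp : w (p : F) = 1) (m : ℕ) {c y μ : F}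
    (hμ : w (μ ^ (p ^ (m + 1) + 1)) = ((1 / ((p : ℚ) - 1) : ℚ) : WithTop ℚ))
    (hc : w c = 0) (hcp : 1 ≤ w (c ^ p - c))
    (hy : y ^ (p ^ (m + 1) * p ^ (m + 1)) = aCoef F p (m + 1) * (c + y) *
      (1 + c * y ^ p ^ (m + 1) + y ^ (p ^ (m + 1) + 1)) ^ (p ^ (m + 1) - 1)) :
    w (μ / (y ^ p ^ (2 * m + 1) / aRoot F p m - c)) =
      ((1 / (((p - 1) * (p ^ (m + 1) + 1) * (p ^ (m + 1) * p ^ (m + 1)) : ℕ) : ℚ) : ℚ) :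
        WithTop ℚ) := by
  have hd := map_aRoot hp hwp m
  have hp2 : (2 : ℚ) ≤ p := by exact_mod_cast hp.two_le
  have hpq : p ≤ p ^ (m + 1) := Nat.le_self_pow (Nat.succ_ne_zero m) p
  have hq2 : (2 : ℚ) ≤ (p : ℚ) ^ (m + 1) := by exact_mod_cast hp.two_le.trans hpq
  rw [← aRoot_pow] at hy
  have hp1 : (0 : ℚ) < p - 1 := by linarith
  have hq1 : (0 : ℚ) < (p : ℚ) ^ (m + 1) - 1 := by linarith
  have hY := map_root_eq (hp.one_le.trans hpq) (pow_eq_coe hd p) (by positivity) hc hy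
  push_cast at hY
  have hW := map_root_pow_div_sub hp hwp (N := p ^ (2 * m + 1)) (hp.two_le.trans hpq) (by ring)
    hY (by positivity) (by
      rw [div_lt_one (by positivity), mul_div_assoc', div_lt_iff₀ hp1]
      nlinarith [mul_nonneg (sub_nonneg.2 hp2) hq1.le, mul_pos hp1 hq1]) (ne_zero_of_eq_coe hd) hc hcp hy
  rw [div_eq_coe (eq_coe_of_pow_eq_coe (Nat.succ_ne_zero _) hμ) hW, WithTop.coe_inj]
  push_cast [Nat.cast_sub hp.one_le]
  field_simp
  ring

end Monodromy

section Degree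

open AddValuation IntermediateField

/-- The additive valuation attached to a map `v` that is multiplicative and ultrametric on nonzero
elements. -/
def addValuationOfNonzero {F : Type} [Field F] (v : F → ℚ)
    (hv_mul : ∀ x y : F, x ≠ 0 → y ≠ 0 → v (x * y) = v x + v y)
    (hv_add : ∀ x y : F, x ≠ 0 → y ≠ 0 → x + y ≠ 0 → min (v x) (v y) ≤ v (x + y)) :
    AddValuation F (WithTop ℚ) := by
  classical
  exact AddValuation.of (fun x => if x = 0 then ⊤ else (v x : WithTop ℚ)) (by simp)
    (by
      have h := hv_mul 1 1 one_ne_zero one_ne_zero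
      rw [mul_one, left_eq_add] at h
      simp [h])
    (fun x y => by
      by_cases hx : x = 0
      · simp [hx]
      by_cases hy : y = 0
      · simp [hy]
      by_cases hxy : x + y = 0
      · simp [hxy]
      simp only [hx, hy, hxy, if_false]
      exact_mod_cast hv_add x y hx hy hxy)
    (fun x y => by
      by_cases hx : x = 0
      · simp [hx]
      by_cases hy : y = 0
      · simp [hy]
      simp only [hx, hy, mul_eq_zero, or_self, if_false]
      exact_mod_cast hv_mul x y hx hy)

lemma addValuationOfNonzero_apply {F : Type} [Field F] {v : F → ℚ}
    {hv_mul : ∀ x y : F, x ≠ 0 → y ≠ 0 → v (x * y) = v x + v y}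
    {hv_add : ∀ x y : F, x ≠ 0 → y ≠ 0 → x + y ≠ 0 → min (v x) (v y) ≤ v (x + y)}
    {x : F} (hx : x ≠ 0) : addValuationOfNonzero v hv_mul hv_add x = (v x : WithTop ℚ) :=
  if_neg hx

/-- A valuation on `Ω` that is nonnegative on the Witt vectors and satisfies `w p = 1` takes
integral values on `K₀`. -/
lemma exists_int_eq_of_Kzero {p : ℕ} [Fact p.Prime] {w : AddValuation (Omg p) (WithTop ℚ)}
    (hwp : w ((p : ℕ) : Omg p) = 1)
    (hW : ∀ x : WittVector p (AlgebraicClosure (ZMod p)), 0 ≤ w (algebraMap (Kzero p) (Omg p)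
      (algebraMap (WittVector p (AlgebraicClosure (ZMod p))) (Kzero p) x)))
    (x : Kzero p) (hx : x ≠ 0) :
    ∃ m : ℤ, w (algebraMap (Kzero p) (Omg p) x) = ((m : ℚ) : WithTop ℚ) := by
  set φ : WittVector p (AlgebraicClosure (ZMod p)) →+* Omg p :=
    (algebraMap (Kzero p) (Omg p)).comp (algebraMap _ (Kzero p))
  have hW' : ∀ a, 0 ≤ w (φ a) := hW
  have hint : ∀ a, a ≠ 0 → ∃ k : ℕ, w (φ a) = ((k : ℚ) : WithTop ℚ) := fun a ha => by
    obtain ⟨k, b, rfl⟩ := WittVector.exists_eq_pow_p_mul' a ha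
    have hb : w (φ b) = ((0 : ℚ) : WithTop ℚ) := by
      refine le_antisymm ?_ (hW' _)
      have h1 : w (φ b * φ ↑b⁻¹) = 0 := by rw [← _root_.map_mul]; simp
      calc w (φ b) ≤ w (φ b * φ ↑b⁻¹) := le_mul_of_nonneg (hW' _)
        _ = 0 := h1
    have hp1 : w (φ (p : WittVector p (AlgebraicClosure (ZMod p)))) = ((1 : ℚ) : WithTop ℚ) := by
      rw [map_natCast, hwp]; rfl
    refine ⟨k, ?_⟩
    rw [_root_.map_mul, _root_.map_pow, mul_eq_coe (pow_eq_coe hp1 k) hb]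
    simp
  obtain ⟨a, b, hb, rfl⟩ := IsFractionRing.div_surjective
    (A := WittVector p (AlgebraicClosure (ZMod p))) x
  have ha : a ≠ 0 := by rintro rfl; simp at hx
  obtain ⟨k, hk⟩ := hint a ha
  obtain ⟨l, hl⟩ := hint b (nonZeroDivisors.ne_zero hb)
  refine ⟨(k : ℤ) - l, ?_⟩
  rw [map_div₀]
  refine (div_eq_coe hk hl).trans ?_
  push_cast
  rfl

lemma natCast_prime_ne_zero (p : ℕ) [Fact p.Prime] : ((p : ℕ) : Omg p) ≠ 0 := by
  have h := WittVector.p_nonzero p (AlgebraicClosure (ZMod p))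
  rw [← (IsFractionRing.injective (WittVector p (AlgebraicClosure (ZMod p))) (Kzero p)).ne_iff,
    ← (algebraMap (Kzero p) (Omg p)).injective.ne_iff] at h
  simpa using h

lemma natDegree_Lpoly_le (R : Type) [CommRing R] {p : ℕ} (hp : p ≠ 0) (n : ℕ) (c : R) :
    (Lpoly R p n c).natDegree ≤ p ^ n * p ^ n := by
  have hq : 1 ≤ p ^ n := Nat.one_le_pow _ _ (Nat.pos_of_ne_zero hp)
  have h1 : (fqc R p n c).natDegree ≤ p ^ n + 1 := by
    refine natDegree_add_le_of_degree_le (natDegree_add_le_of_degree_le (by simp) ?_)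
      (natDegree_X_pow_le _)
    exact (natDegree_C_mul_X_pow_le _ _).trans (Nat.le_succ _)
  have h2 : (C (aCoef R p n) * (C c + X)).natDegree ≤ 1 :=
    (natDegree_C_mul_le _ _).trans (natDegree_add_le_of_degree_le (by simp) natDegree_X_le)
  refine natDegree_sub_le_of_le (natDegree_X_pow_le _)
    (natDegree_mul_le_of_le h2 (natDegree_pow_le_of_le _ h1)) |>.trans ?_
  obtain ⟨k, hk⟩ := Nat.exists_eq_add_of_le hq
  rw [hk, max_le_iff, Nat.add_sub_cancel_left]
  constructor <;> nlinarith

lemma aeval_Lpoly {R S : Type} [CommRing R] [CommRing S] [Algebra R S] (p n : ℕ) (c : R) (y : S) :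
    aeval y (Lpoly R p n c) = y ^ (p ^ n * p ^ n) - aCoef S p n * (algebraMap R S c + y) *
      (1 + algebraMap R S c * y ^ p ^ n + y ^ (p ^ n + 1)) ^ (p ^ n - 1) := by
  simp [Lpoly, fqc, aCoef]

lemma finrank_adjoin_le_of_pow_add_one {k E : Type*} [Field k] [Field E] [Algebra k E] {p : ℕ}
    (hp : p.Prime) (h0 : (p : E) ≠ 0) {ζ μ : E} (hζ : IsPrimitiveRoot ζ p) {e : ℕ} (he : e ≠ 0)
    (hμ : μ ^ e = ζ - 1) :
    IsIntegral k μ ∧ Module.finrank k k⟮μ⟯ ≤ (p - 1) * e := by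
  have hmonic : ((cyclotomic p k).comp (X ^ e + 1)).Monic :=
    (cyclotomic.monic p k).comp (by simpa using monic_X_pow_add_C (1 : k) he)
      (by rw [← C_1, natDegree_X_pow_add_C]; exact he)
  have hroot : aeval μ ((cyclotomic p k).comp (X ^ e + 1)) = 0 := by
    have : NeZero (p : E) := ⟨h0⟩
    rw [aeval_comp]
    simp only [_root_.map_add, _root_.map_pow, aeval_X, _root_.map_one, hμ, sub_add_cancel]
    rw [aeval_def, eval₂_eq_eval_map, map_cyclotomic]
    exact hζ.isRoot_cyclotomic hp.pos
  have hint : IsIntegral k μ := ⟨_, hmonic, hroot⟩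
  refine ⟨hint, ?_⟩
  rw [adjoin.finrank hint]
  refine (natDegree_le_of_dvd (minpoly.dvd k μ hroot) hmonic.ne_zero).trans ?_
  rw [natDegree_comp, natDegree_cyclotomic, Nat.totient_prime hp, ← C_1, natDegree_X_pow_add_C]

/-- If `y` is a root of `f ≠ 0` over `k₀(μ)`, and some `t ∈ k₀(μ)(y)` has valuation `1 / (e N)` with
`N ≥ deg f` and `[k₀(μ) : k₀] ≤ e`, then `k₀(μ)(y)` has degree `N` over `k₀(μ)`. -/
lemma irreducible_and_finrank_eq {k₀ E : Type*} [Field k₀] [Field E] [Algebra k₀ E]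
    {w : AddValuation E (WithTop ℚ)}
    (hk : ∀ x : k₀, x ≠ 0 → ∃ m : ℤ, w (algebraMap k₀ E x) = ((m : ℚ) : WithTop ℚ))
    {μ : E} (hμ : IsIntegral k₀ μ) {e N : ℕ} (he0 : 0 < e)
    (he : Module.finrank k₀ k₀⟮μ⟯ ≤ e) {f : Polynomial k₀⟮μ⟯} (hf0 : f ≠ 0)
    (hf : f.natDegree ≤ N) {y t : E} (hy : aeval y f = 0)
    (hty : t ∈ adjoin k₀⟮μ⟯ {y}) (ht : w t = ((1 / ((e * N : ℕ) : ℚ) : ℚ) : WithTop ℚ)) :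
    Irreducible f ∧ Module.finrank k₀⟮μ⟯ (adjoin k₀⟮μ⟯ {y}) = N := by
  have hint : IsIntegral k₀⟮μ⟯ y :=
    (isAlgebraic_iff_isIntegral).1 ⟨f, hf0, hy⟩
  have := adjoin.finiteDimensional hμ
  have := adjoin.finiteDimensional hint
  have : FiniteDimensional k₀ (adjoin k₀⟮μ⟯ {y}) := FiniteDimensional.trans k₀ k₀⟮μ⟯ _
  have hlin := linearIndependent_pow hk ht
  have hlin' : LinearIndependent k₀
      fun i : Fin (e * N) => (⟨t, hty⟩ : adjoin k₀⟮μ⟯ {y}) ^ (i : ℕ) :=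
    LinearIndependent.of_comp
      (((adjoin k₀⟮μ⟯ {y}).val.restrictScalars k₀).toLinearMap) hlin
  have : Module.Free k₀⟮μ⟯ (adjoin k₀⟮μ⟯ {y}) := Module.Free.of_divisionRing _ _
  have hmul : Module.finrank k₀ k₀⟮μ⟯ * Module.finrank k₀⟮μ⟯ (adjoin k₀⟮μ⟯ {y}) =
      Module.finrank k₀ (adjoin k₀⟮μ⟯ {y}) := Module.finrank_mul_finrank _ _ _
  have hcard := hlin'.fintype_card_le_finrank
  rw [Fintype.card_fin, ← hmul] at hcard
  have hge : N ≤ Module.finrank k₀⟮μ⟯ (adjoin k₀⟮μ⟯ {y}) :=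
    Nat.le_of_mul_le_mul_left (hcard.trans (Nat.mul_le_mul_right _ he)) he0
  have hdvd := minpoly.dvd k₀⟮μ⟯ y hy
  have hfin := adjoin.finrank hint
  have hle := natDegree_le_of_dvd hdvd hf0
  refine ⟨?_, by omega⟩
  exact (associated_of_dvd_of_natDegree_le hdvd hf0 (by omega)).irreducible (minpoly.irreducible hint)

end Degree

set_option maxHeartbeats 1000000

/-- for `c ∈ O_K` with `v(c^p − c) ≥ 1` and `v(c) < p/((q+1)(p−1))`, the polynomial
`L_c` is irreducible over `K = K₀(μ)`; in particular `K(y)/K` has degree `q²` and is totally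
ramified (there is `t ∈ K(y)` with `v(t) = 1/((p−1)(q+1)q²)`, a uniformizer of `K(y)`). -/
theorem stmt_9 (p n : ℕ) [Fact p.Prime] (hn : 1 ≤ n)
    (v : Omg p → ℚ)
    (hv_mul : ∀ x y : Omg p, x ≠ 0 → y ≠ 0 → v (x * y) = v x + v y)
    (hv_add : ∀ x y : Omg p, x ≠ 0 → y ≠ 0 → x + y ≠ 0 → min (v x) (v y) ≤ v (x + y))
    (hv_p : v ((p : ℕ) : Omg p) = 1)
    (hv_W : ∀ x : WittVector p (AlgebraicClosure (ZMod p)), x ≠ 0 →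
      0 ≤ v (algebraMap (Kzero p) (Omg p)
        (algebraMap (WittVector p (AlgebraicClosure (ZMod p))) (Kzero p) x)))
    (ζ : Omg p) (hζ : IsPrimitiveRoot ζ p)
    (μ : Omg p) (hμ : μ ^ (p ^ n + 1) = ζ - 1)
    (c : ↥(IntermediateField.adjoin (Kzero p) {μ}))
    (hc0 : (c : Omg p) ≠ 0) (hc_nonneg : 0 ≤ v (c : Omg p))
    (hcp : (c : Omg p) ^ p - (c : Omg p) = 0 ∨ 1 ≤ v ((c : Omg p) ^ p - (c : Omg p)))
    (hc_lt : v (c : Omg p) < (p : ℚ) / (((p : ℚ) ^ n + 1) * ((p : ℚ) - 1))) :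
    Irreducible (Lpoly ↥(IntermediateField.adjoin (Kzero p) {μ}) p n c) ∧
    ∀ y : Omg p, Polynomial.aeval y (Lpoly ↥(IntermediateField.adjoin (Kzero p) {μ}) p n c) = 0 →
      Module.finrank ↥(IntermediateField.adjoin (Kzero p) {μ})
        ↥(IntermediateField.adjoin ↥(IntermediateField.adjoin (Kzero p) {μ}) {y}) =
          p ^ n * p ^ n ∧
      ∃ t : Omg p, t ∈ IntermediateField.adjoin ↥(IntermediateField.adjoin (Kzero p) {μ}) {y} ∧
        t ≠ 0 ∧ v t = 1 / (((p : ℚ) - 1) * ((p : ℚ) ^ n + 1) * (p : ℚ) ^ (2 * n)) := by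
  have hp : p.Prime := Fact.out
  obtain ⟨m, rfl⟩ : ∃ m, n = m + 1 := ⟨n - 1, (Nat.sub_add_cancel hn).symm⟩
  have hp2 : (2 : ℚ) ≤ p := by exact_mod_cast hp.two_le
  have hpq : p ≤ p ^ (m + 1) := Nat.le_self_pow (Nat.succ_ne_zero m) p
  have hpq' : (p : ℚ) ≤ (p : ℚ) ^ (m + 1) := by exact_mod_cast hpq
  set w := addValuationOfNonzero v hv_mul hv_add
  have hwv : ∀ x, x ≠ 0 → w x = (v x : WithTop ℚ) := fun x hx => addValuationOfNonzero_apply hx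
  have hp0 : ((p : ℕ) : Omg p) ≠ 0 := natCast_prime_ne_zero p
  have hwp : w ((p : ℕ) : Omg p) = 1 := by rw [hwv _ hp0, hv_p]; rfl
  have hcw := hwv _ hc0
  have hcp' : 1 ≤ w ((c : Omg p) ^ p - c) := by
    by_cases h0 : (c : Omg p) ^ p - c = 0
    · simp [h0]
    · rw [hwv _ h0]
      exact_mod_cast hcp.resolve_left h0
  have hc1 : v (c : Omg p) < 1 := by
    refine hc_lt.trans_le ?_
    rw [div_le_one (by apply mul_pos <;> linarith)]
    nlinarith
  have hc : w (c : Omg p) = 0 := by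
    rw [hcw]
    refine congrArg _ (le_antisymm ?_ hc_nonneg)
    by_contra! hpos
    have hlt : w (c : Omg p) < w ((c : Omg p) ^ p) := by
      rw [AddValuation.pow_eq_coe hcw, hcw, WithTop.coe_lt_coe]
      nlinarith
    rw [w.map_sub_eq_of_lt_right hlt, hcw] at hcp'
    exact hc1.not_ge (by exact_mod_cast hcp')
  have hk := exists_int_eq_of_Kzero hwp fun x => by
    by_cases hx : x = 0
    · simp [hx]
    · rw [hwv]
      · exact_mod_cast hv_W x hx
      · simpa using hx
  obtain ⟨hμint, hμle⟩ := finrank_adjoin_le_of_pow_add_one (k := Kzero p) hp hp0 hζ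
    (Nat.succ_ne_zero (p ^ (m + 1))) hμ
  have hμw := AddValuation.sub_one_eq_of_isPrimitiveRoot hp hwp hζ
  rw [← hμ] at hμw
  set L := Lpoly ↥(IntermediateField.adjoin (Kzero p) {μ}) p (m + 1) c
  have hdeg : L.natDegree ≤ p ^ (m + 1) * p ^ (m + 1) := natDegree_Lpoly_le _ hp.ne_zero _ _
  have ha : aCoef (Omg p) p (m + 1) ≠ 0 := by
    rw [← aRoot_pow]
    exact pow_ne_zero _ (AddValuation.ne_zero_of_eq_coe (map_aRoot hp hwp m))
  have hL_eval : ∀ y : Omg p, aeval y L = y ^ (p ^ (m + 1) * p ^ (m + 1)) -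
      aCoef (Omg p) p (m + 1) * (c + y) *
        (1 + c * y ^ p ^ (m + 1) + y ^ (p ^ (m + 1) + 1)) ^ (p ^ (m + 1) - 1) :=
    fun y => aeval_Lpoly p (m + 1) c y
  have hq0 : p ^ (m + 1) ≠ 0 := pow_ne_zero _ hp.ne_zero
  have hL0 : aeval (0 : Omg p) L ≠ 0 := by
    rw [hL_eval]
    simp [hp.ne_zero, ha, hc0]
  have hLne : L ≠ 0 := by
    intro h
    simp [h] at hL0
  have hmain : ∀ y : Omg p, aeval y L = 0 → Irreducible L ∧ Module.finrank
      ↥(IntermediateField.adjoin (Kzero p) {μ})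
        ↥(IntermediateField.adjoin ↥(IntermediateField.adjoin (Kzero p) {μ}) {y}) =
          p ^ (m + 1) * p ^ (m + 1) ∧
      ∃ t : Omg p, t ∈ IntermediateField.adjoin ↥(IntermediateField.adjoin (Kzero p) {μ}) {y} ∧
        t ≠ 0 ∧
        v t = 1 / (((p : ℚ) - 1) * ((p : ℚ) ^ (m + 1) + 1) * (p : ℚ) ^ (2 * (m + 1))) := by
    intro y hy
    have hyeq := hL_eval y
    rw [hy, eq_comm, sub_eq_zero] at hyeq
    have ht := map_uniformizer hp hwp m hμw hc hcp' hyeq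
    set E := IntermediateField.adjoin ↥(IntermediateField.adjoin (Kzero p) {μ}) {y}
    set t := μ / (y ^ p ^ (2 * m + 1) / aRoot (Omg p) p m - c)
    have hyE : y ∈ E := IntermediateField.mem_adjoin_simple_self _ y
    have hcE : (c : Omg p) ∈ E := E.algebraMap_mem c
    have hμE : μ ∈ E := E.algebraMap_mem (IntermediateField.AdjoinSimple.gen (Kzero p) μ)
    have haE : aRoot (Omg p) p m ∈ E :=
      mul_mem (pow_mem (neg_mem (one_mem E)) _) (pow_mem (neg_mem (natCast_mem E p)) _)
    have htE : t ∈ E := div_mem hμE (sub_mem (div_mem (pow_mem hyE _) haE) hcE)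
    have ht0 : t ≠ 0 := AddValuation.ne_zero_of_eq_coe ht
    obtain ⟨hirr, hrank⟩ := irreducible_and_finrank_eq hk hμint
      (Nat.mul_pos (Nat.sub_pos_of_lt hp.one_lt) (Nat.succ_pos _)) hμle hLne hdeg hy htE ht
    refine ⟨hirr, hrank, t, htE, ht0, ?_⟩
    rw [hwv t ht0, WithTop.coe_inj] at ht
    rw [ht]
    push_cast [Nat.cast_sub hp.one_le]
    ring
  refine ⟨?_, fun y hy => (hmain y hy).2⟩
  obtain ⟨y, hy⟩ : ∃ y : Omg p, aeval y L = 0 := by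
    refine IsAlgClosed.exists_aeval_eq_zero _ L fun h => ?_
    have hconst := eq_C_of_degree_eq_zero h
    have h1 : aeval (0 : Omg p) L = aeval (-(c : Omg p)) L := by
      rw [hconst, aeval_C, aeval_C]
    have hA := map_aRoot hp hwp m
    rw [hL_eval, hL_eval] at h1
    simp only [ne_eq, mul_eq_zero, hq0, or_self, not_false_eq_true, zero_pow, add_zero, mul_zero,
      Nat.succ_ne_zero, one_pow, mul_one, zero_sub, add_neg_cancel, zero_mul, sub_zero] at h1
    have h2 := congrArg w h1
    have hac := AddValuation.mul_eq_coe (AddValuation.pow_eq_coe hA p) hcw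
    rw [aRoot_pow] at hac
    rw [w.map_neg, hac, w.map_pow, w.map_neg, hc, smul_zero] at h2
    have h3 : (p : ℚ) * (((p : ℚ) ^ (m + 1) - 1) / (p - 1)) + v (c : Omg p) = 0 := by
      exact_mod_cast h2
    have hpos : 0 < (p : ℚ) * (((p : ℚ) ^ (m + 1) - 1) / (p - 1)) :=
      mul_pos (by linarith) (div_pos (by linarith) (by linarith))
    linarith
  exact (hmain y hy).1
end
end
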